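/- For each rational number x ∈ (0,1), there does not exist a polynomial modulus of continuity of F at x: there is no polynomial P with natural number coefficients such that for all n ∈ ℕ and all y ∈ [0,1], |y − x| ≤ 2^{−P(n)} implies |F(y) − F(x)| ≤ 2^{−n}. -/

import Mathlib

open scoped BigOperators

/-- The piecewise linear "step" function `β_{p,q}` on `[0,1]`. -/
noncomputable def beta (p q : ℕ) (x : ℝ) : ℝ :=
  if x ≤ (p : ℝ) / q then 0
  else if x ≤ ((p : ℝ) + (2:ℝ) ^ (-(q:ℤ))) / q then (2:ℝ) ^ q * (x - (p : ℝ) / q)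
  else 1 / q

/-- `α_q(x) = ∑_{p=0}^{q-1} β_{p,q}(x)`. -/
noncomputable def alpha (q : ℕ) (x : ℝ) : ℝ := ∑ p ∈ Finset.range q, beta p q x

/-- `F(x) = ∑_{q=1}^∞ (1/q²)·α_q(x)`. -/
noncomputable def F (x : ℝ) : ℝ := ∑' q : ℕ, (1 / ((q:ℝ) + 1) ^ 2) * alpha (q + 1) x

open Filter Topology

theorem beta_eq_min_max (p : ℕ) {q : ℕ} (hq : 0 < q) (x : ℝ) :
    beta p q x = min (1 / (q : ℝ)) (max 0 ((2 : ℝ) ^ q * (x - (p : ℝ) / q))) := by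
  have hq' : (0 : ℝ) < q := by exact_mod_cast hq
  have h2 : (0 : ℝ) < 2 ^ q := by positivity
  have hinv : (0 : ℝ) < 1 / q := by positivity
  have hsplit : ((p : ℝ) + (2 : ℝ) ^ (-(q : ℤ))) / q = p / q + 1 / q / 2 ^ q := by
    rw [zpow_neg, zpow_natCast]; field_simp
  unfold beta
  rw [hsplit]
  split_ifs with h h'
  · rw [max_eq_left (mul_nonpos_of_nonneg_of_nonpos h2.le (by linarith)), min_eq_right hinv.le]
  · push Not at h
    have hle : x - (p : ℝ) / q ≤ 1 / q / 2 ^ q := by linarith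
    rw [le_div_iff₀ h2] at hle
    rw [max_eq_right (mul_nonneg h2.le (by linarith)), min_eq_right (by linarith)]
  · push Not at h'
    have hlt : 1 / (q : ℝ) / 2 ^ q < x - (p : ℝ) / q := by linarith
    rw [div_lt_iff₀ h2] at hlt
    rw [min_eq_left (le_max_of_le_right (by linarith))]

theorem beta_monotone (p : ℕ) {q : ℕ} (hq : 0 < q) : Monotone (beta p q) := by
  intro x y hxy
  rw [beta_eq_min_max p hq, beta_eq_min_max p hq]
  gcongr

theorem beta_nonneg (p : ℕ) {q : ℕ} (hq : 0 < q) (x : ℝ) : 0 ≤ beta p q x := by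
  rw [beta_eq_min_max p hq]
  positivity

theorem beta_le (p : ℕ) {q : ℕ} (hq : 0 < q) (x : ℝ) : beta p q x ≤ 1 / q := by
  rw [beta_eq_min_max p hq]
  exact min_le_left _ _

theorem beta_left (p q : ℕ) : beta p q ((p : ℝ) / q) = 0 := by
  simp [beta]

theorem beta_right (p : ℕ) {q : ℕ} (hq : 0 < q) :
    beta p q ((p : ℝ) / q + 1 / q / 2 ^ q) = 1 / q := by
  have h : (2 : ℝ) ^ q * ((p : ℝ) / q + 1 / q / 2 ^ q - p / q) = 1 / q := by
    rw [add_sub_cancel_left]; field_simp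
  rw [beta_eq_min_max p hq, h, max_eq_right (by positivity), min_self]

theorem alpha_monotone {q : ℕ} (hq : 0 < q) : Monotone (alpha q) := fun _ _ hxy =>
  Finset.sum_le_sum fun p _ => beta_monotone p hq hxy

theorem alpha_nonneg {q : ℕ} (hq : 0 < q) (x : ℝ) : 0 ≤ alpha q x :=
  Finset.sum_nonneg fun p _ => beta_nonneg p hq x

theorem alpha_le_one {q : ℕ} (hq : 0 < q) (x : ℝ) : alpha q x ≤ 1 := by
  have hq' : (q : ℝ) ≠ 0 := by exact_mod_cast hq.ne'
  calc alpha q x ≤ ∑ _p ∈ Finset.range q, 1 / (q : ℝ) :=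
        Finset.sum_le_sum fun p _ => beta_le p hq x
    _ = 1 := by simp [hq']

theorem beta_sub_le_alpha_sub {p q : ℕ} (hpq : p < q) {x y : ℝ} (hxy : x ≤ y) :
    beta p q y - beta p q x ≤ alpha q y - alpha q x := by
  unfold alpha
  rw [← Finset.sum_sub_distrib]
  exact Finset.single_le_sum (f := fun p => beta p q y - beta p q x)
    (fun i _ => sub_nonneg.2 (beta_monotone i (by omega) hxy)) (Finset.mem_range.2 hpq)

theorem summable_F (x : ℝ) :
    Summable fun q : ℕ => (1 / ((q : ℝ) + 1) ^ 2) * alpha (q + 1) x := by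
  have hs : Summable fun q : ℕ => 1 / ((q : ℝ) + 1) ^ 2 := by
    have := (summable_nat_add_iff 1).2 (Real.summable_one_div_nat_pow.2 one_lt_two)
    simpa using this
  refine Summable.of_nonneg_of_le (fun q => ?_) (fun q => ?_) hs
  · exact mul_nonneg (by positivity) (alpha_nonneg q.succ_pos x)
  · exact mul_le_of_le_one_right (by positivity) (alpha_le_one q.succ_pos x)

theorem alpha_sub_le_F_sub {q : ℕ} (hq : 0 < q) {x y : ℝ} (hxy : x ≤ y) :
    1 / (q : ℝ) ^ 2 * (alpha q y - alpha q x) ≤ F y - F x := by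
  obtain ⟨q, rfl⟩ := Nat.exists_eq_add_one.2 hq
  unfold F
  rw [← (summable_F y).tsum_sub (summable_F x)]
  have h := ((summable_F y).sub (summable_F x)).le_tsum q fun j _ => by
    rw [← mul_sub]
    exact mul_nonneg (by positivity) (sub_nonneg.2 (alpha_monotone j.succ_pos hxy))
  rw [← mul_sub] at h
  simpa using h

/-- `F` increases by at least `1 / q ^ 3` on an interval of length `2 ^ (-q) / q` starting at
`p / q`. -/
theorem inv_cube_le_F_sub {p q : ℕ} (hpq : p < q) :
    ((q : ℝ) ^ 3)⁻¹ ≤ F ((p : ℝ) / q + 1 / q / 2 ^ q) - F ((p : ℝ) / q) := by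
  have hq : 0 < q := by omega
  have hq' : (0 : ℝ) < q := by exact_mod_cast hq
  have hxy : (p : ℝ) / q ≤ (p : ℝ) / q + 1 / q / 2 ^ q := le_add_of_nonneg_right (by positivity)
  have hb := beta_sub_le_alpha_sub hpq hxy
  rw [beta_right p hq, beta_left, sub_zero] at hb
  calc ((q : ℝ) ^ 3)⁻¹ = 1 / (q : ℝ) ^ 2 * (1 / q) := by field_simp
    _ ≤ 1 / (q : ℝ) ^ 2 * (alpha q ((p : ℝ) / q + 1 / q / 2 ^ q) - alpha q ((p : ℝ) / q)) := by
        gcongr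
    _ ≤ _ := alpha_sub_le_F_sub hq hxy

theorem tendsto_polynomial_eval_div_two_pow (Q : Polynomial ℕ) :
    Tendsto (fun m : ℕ => ((Q.eval m : ℕ) : ℝ) / 2 ^ m) atTop (𝓝 0) := by
  induction Q using Polynomial.induction_on' with
  | add P Q hP hQ => simpa [add_div] using hP.add hQ
  | monomial d c =>
    simpa [mul_div_assoc] using
      (tendsto_pow_const_div_const_pow_of_one_lt d (one_lt_two (α := ℝ))).const_mul (c : ℝ)

theorem exists_polynomial_eval_le_two_pow (Q : Polynomial ℕ) : ∃ m : ℕ, Q.eval m ≤ 2 ^ m := by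
  obtain ⟨m, hm⟩ :=
    ((tendsto_polynomial_eval_div_two_pow Q).eventually (gt_mem_nhds one_pos)).exists
  rw [div_lt_one (by positivity)] at hm
  exact ⟨m, by exact_mod_cast hm.le⟩

theorem no_polynomial_pointwise_modulus (x : ℚ) (h0 : 0 < x) (h1 : x < 1) :
    ¬ ∃ P : Polynomial ℕ, ∀ n : ℕ, ∀ y ∈ Set.Icc (0:ℝ) 1,
      |y - (x : ℝ)| ≤ ((2:ℝ) ^ (P.eval n))⁻¹ → |F y - F (x : ℝ)| ≤ ((2:ℝ) ^ n)⁻¹ := by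
  rintro ⟨P, hP⟩
  obtain ⟨a, b, hab, hx⟩ : ∃ a b : ℕ, a < b ∧ (x : ℝ) = a / b := by
    have hnum : ((x.num.toNat : ℕ) : ℤ) = x.num := Int.toNat_of_nonneg (Rat.num_pos.2 h0).le
    refine ⟨x.num.toNat, x.den, ?_, ?_⟩
    · have := Rat.num_lt_denom_iff.2 h1
      omega
    · rw [Rat.cast_def, ← hnum, Int.cast_natCast, Int.toNat_natCast]
  obtain ⟨m, hm⟩ := exists_polynomial_eval_le_two_pow
    (P.comp (Polynomial.C 3 * (Polynomial.C b + Polynomial.X)))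
  simp only [Polynomial.eval_comp, Polynomial.eval_mul, Polynomial.eval_add, Polynomial.eval_C,
    Polynomial.eval_X] at hm
  have hb : 0 < b := by omega
  set q := b * 2 ^ m with hq_def
  have hpq : a * 2 ^ m < q := Nat.mul_lt_mul_of_pos_right hab (by positivity)
  have hq : 0 < q := by omega
  have hq1 : (1 : ℝ) ≤ q := by exact_mod_cast hq
  have hxq : (x : ℝ) = ((a * 2 ^ m : ℕ) : ℝ) / q := by
    rw [hx, hq_def]
    push_cast
    rw [mul_div_mul_right _ _ (by positivity)]
  have hjump := inv_cube_le_F_sub hpq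
  rw [← hxq] at hjump
  have hlen : 1 / (q : ℝ) / 2 ^ q ≤ (2 ^ P.eval (3 * (b + m)))⁻¹ := by
    calc 1 / (q : ℝ) / 2 ^ q ≤ 1 / 2 ^ q := by
          gcongr
          exact (div_le_one (by positivity)).2 hq1
      _ ≤ _ := by
          rw [one_div]
          gcongr
          · exact one_le_two
          · exact hm.trans (Nat.le_mul_of_pos_left _ hb)
  have hy0 : (0 : ℝ) ≤ x + 1 / q / 2 ^ q := by
    have : (0 : ℝ) ≤ x := by exact_mod_cast h0.le
    positivity
  have hy1 : (x : ℝ) + 1 / q / 2 ^ q ≤ 1 := by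
    have hstep : 1 / (q : ℝ) / 2 ^ q ≤ 1 / q :=
      div_le_self (by positivity) (one_le_pow₀ one_le_two)
    calc (x : ℝ) + 1 / q / 2 ^ q ≤ x + 1 / q := by linarith
      _ = (((a * 2 ^ m : ℕ) : ℝ) + 1) / q := by rw [hxq]; ring
      _ ≤ 1 := by
          rw [div_le_one (by positivity)]
          exact_mod_cast hpq
  have hmod := hP (3 * (b + m)) _ ⟨hy0, hy1⟩
    (by rwa [add_sub_cancel_left, abs_of_nonneg (by positivity)])
  have hle := hjump.trans ((le_abs_self _).trans hmod)
  rw [inv_le_inv₀ (by positivity) (by positivity)] at hle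
  have hlt : q ^ 3 < 2 ^ (3 * (b + m)) := by
    rw [mul_comm 3, pow_mul, pow_add]
    exact Nat.pow_lt_pow_left
      (Nat.mul_lt_mul_of_pos_right Nat.lt_two_pow_self (by positivity)) (by norm_num)
  have hle' : 2 ^ (3 * (b + m)) ≤ q ^ 3 := by exact_mod_cast hle
  omega
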